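/- Let n ≥ 2 and let k be an even integer. Let M = (a, b; c, d) ∈ SAV(ℝ⊕ℝ^{n−1}) and let f : H⁺ → Cl_n satisfy f(x) = (conj(cx+d)/‖cx+d‖^{n+1−k}) · f(M<x>) for all x ∈ H⁺. Then g(x) := x_n^{−(1−n+k)/2} f(x) satisfies g(x) = (conj(cx+d)/‖cx+d‖²) · g(M<x>) for all x ∈ H⁺ (here x_n^{−(1−n+k)/2} is the real power of x_n > 0). -/

import Mathlib

noncomputable section

open scoped symmDiff

/-- An explicit model of the real Clifford algebra `Cl_n` with generators `e 0, …, e (n-1)`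
satisfying `eᵢ eⱼ + eⱼ eᵢ = -2 δᵢⱼ` (the Clifford algebra of the negative definite
quadratic form on `ℝⁿ`): elements are coordinate functions on the canonical basis
`(e_A)_{A ⊆ {0,…,n-1}}`, where `e_A` is the (increasingly ordered) product of the `e i`, `i ∈ A`. -/
def Cl (n : ℕ) : Type := Finset (Fin n) → ℝ

namespace Cl

variable {n : ℕ}

instance : NormedAddCommGroup (Cl n) :=
  inferInstanceAs (NormedAddCommGroup (Finset (Fin n) → ℝ))

instance : NormedSpace ℝ (Cl n) :=
  inferInstanceAs (NormedSpace ℝ (Finset (Fin n) → ℝ))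

/-- The coefficient of `a` at the basis element `e_A`. -/
def coeff (a : Cl n) (A : Finset (Fin n)) : ℝ := a A

/-- The sign occurring in the product `e_A * e_B = mulSign A B • e_{A ∆ B}`,
coming from the relations `eᵢ eⱼ = -eⱼ eᵢ` (i ≠ j) and `eᵢ² = -1`. -/
def mulSign (A B : Finset (Fin n)) : ℝ :=
  (-1 : ℝ) ^ (((A ×ˢ B).filter fun p => p.2 < p.1).card + (A ∩ B).card)

/-- Clifford multiplication. -/
def mul (a b : Cl n) : Cl n := fun C =>
  ∑ A : Finset (Fin n), ∑ B : Finset (Fin n),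
    if A ∆ B = C then mulSign A B * a A * b B else 0

/-- The unit `1` of the Clifford algebra. -/
def one : Cl n := Pi.single ∅ 1

/-- The embedding of the real scalars. -/
def scalar (r : ℝ) : Cl n := Pi.single ∅ r

/-- The generators `e i` (in the paper: `e_1, …, e_n`). -/
def e (i : Fin n) : Cl n := Pi.single {i} 1

/-- Reversion: the anti-automorphism fixing all the `e i`. -/
def reverse (a : Cl n) : Cl n := fun A => (-1 : ℝ) ^ (A.card * (A.card - 1) / 2) * a A

/-- The main involution `′`: the automorphism with `(e i)′ = - e i`. -/
def involute (a : Cl n) : Cl n := fun A => (-1 : ℝ) ^ A.card * a A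

/-- Clifford conjugation: the anti-automorphism with `conj (e i) = - e i`
(the composite of reversion and the main involution). -/
def conj (a : Cl n) : Cl n := fun A => (-1 : ℝ) ^ (A.card * (A.card + 1) / 2) * a A

/-- The norm on `Cl n`: the square root of the sum of the squares of the
coordinates in the standard basis. -/
def norm (a : Cl n) : ℝ := Real.sqrt (∑ A : Finset (Fin n), a A ^ 2)

/-- Invertibility in the Clifford algebra. -/
def IsInvertible (a : Cl n) : Prop := ∃ b, mul a b = one ∧ mul b a = one

/-- The inverse of an invertible Clifford number (junk value `0` otherwise). -/
def inv (a : Cl n) : Cl n :=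
  letI := Classical.propDecidable (IsInvertible a)
  if h : IsInvertible a then h.choose else 0

/-- The paravector `x₀ + x₁ e₁ + ⋯ + xₙ eₙ` attached to `x ∈ ℝ^{n+1}`. -/
def para (x : Fin (n + 1) → ℝ) : Cl n :=
  scalar (x 0) + ∑ i : Fin n, x i.succ • e i

/-- Being a paravector. -/
def IsParavector (a : Cl n) : Prop := ∃ x : Fin (n + 1) → ℝ, a = para x

/-- The coordinates in `ℝ^{n+1}` of (the paravector part of) a Clifford number. -/
def paraCoord (a : Cl n) : Fin (n + 1) → ℝ :=
  Fin.cases (coeff a ∅) (fun i => coeff a {i})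

/-- Being a (possibly empty) product of nonzero paravectors. -/
def IsProdOfParavectors (a : Cl n) : Prop :=
  ∃ l : List (Fin (n + 1) → ℝ), (∀ x ∈ l, x ≠ 0) ∧
    a = l.foldr (fun x b => mul (para x) b) one

/-- The special Ahlfors–Vahlen group `SAV(ℝ ⊕ ℝⁿ)`: 2×2 matrices `(a b; c d)` with entries
in `Cl n` such that each entry is `0` or a product of nonzero paravectors,
`a ⬝ reverse d - b ⬝ reverse c = 1`, and `a c⁻¹, c⁻¹ d` are paravectors if `c ≠ 0`
resp. `b d⁻¹` is a paravector if `c = 0`. -/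
structure SAV (n : ℕ) where
  a : Cl n
  b : Cl n
  c : Cl n
  d : Cl n
  prod_a : a = 0 ∨ IsProdOfParavectors a
  prod_b : b = 0 ∨ IsProdOfParavectors b
  prod_c : c = 0 ∨ IsProdOfParavectors c
  prod_d : d = 0 ∨ IsProdOfParavectors d
  det : mul a (reverse d) - mul b (reverse c) = one
  cond_c : c ≠ 0 → IsParavector (mul a (inv c)) ∧ IsParavector (mul (inv c) d)
  cond_c0 : c = 0 → IsParavector (mul b (inv d))

/-- The Clifford number `c x + d` attached to a matrix `M` and `x ∈ ℝ^{n+1}`. -/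
def cxd (M : SAV n) (x : Fin (n + 1) → ℝ) : Cl n := mul M.c (para x) + M.d

/-- The numerator `a x + b`. -/
def axb (M : SAV n) (x : Fin (n + 1) → ℝ) : Cl n := mul M.a (para x) + M.b

/-- The Möbius transformation `M<x> = (ax+b)(cx+d)⁻¹` as a Clifford number. -/
def moebiusCl (M : SAV n) (x : Fin (n + 1) → ℝ) : Cl n := mul (axb M x) (inv (cxd M x))

/-- The Möbius transformation `M<x>` as a point of `ℝ^{n+1}`. -/
def moebius (M : SAV n) (x : Fin (n + 1) → ℝ) : Fin (n + 1) → ℝ :=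
  paraCoord (moebiusCl M x)

/-- `a` lies in the subalgebra `Cl_{n-1}` generated by the `e j` with `j ≠ i`. -/
def memSub (a : Cl n) (i : Fin n) : Prop := ∀ A : Finset (Fin n), i ∈ A → coeff a A = 0

/-- The subgroup `SAV(ℝ ⊕ ℝ^{m})` of `SAV(ℝ ⊕ ℝ^{m+1})` of matrices whose entries lie
in the subalgebra `Cl_m ⊆ Cl_{m+1}`. -/
structure SAVsub (m : ℕ) extends SAV (m + 1) where
  sub_a : memSub a (Fin.last m)
  sub_b : memSub b (Fin.last m)
  sub_c : memSub c (Fin.last m)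
  sub_d : memSub d (Fin.last m)

/-- The `P`-part of `a ∈ Cl_{m+1} = Cl_m ⊕ Cl_m e_{top}`: `a = P a + (Q a) e_top`. -/
def Ppart {m : ℕ} (a : Cl (m + 1)) : Cl (m + 1) := fun A =>
  if Fin.last m ∈ A then 0 else a A

/-- The `Q`-part of `a ∈ Cl_{m+1} = Cl_m ⊕ Cl_m e_{top}`: `a = P a + (Q a) e_top`. -/
def Qpart {m : ℕ} (a : Cl (m + 1)) : Cl (m + 1) := fun A =>
  if Fin.last m ∈ A then 0 else a (insert (Fin.last m) A)

/-- Partial derivative `∂f/∂xᵢ`. -/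
def pderiv {E : Type*} [NormedAddCommGroup E] [NormedSpace ℝ E] {m : ℕ}
    (i : Fin m) (f : (Fin m → ℝ) → E) (x : Fin m → ℝ) : E :=
  fderiv ℝ f x (Pi.single i 1)

/-- The Euclidean Laplacian `Δ = Σᵢ ∂²/∂xᵢ²` (acting componentwise). -/
def lap {E : Type*} [NormedAddCommGroup E] [NormedSpace ℝ E] {m : ℕ}
    (f : (Fin m → ℝ) → E) : (Fin m → ℝ) → E :=
  fun x => ∑ i : Fin m, pderiv i (pderiv i f) x

/-- The Euclidean Dirac operator `D f = ∂f/∂x₀ + Σᵢ eᵢ ∂f/∂xᵢ`. -/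
def dirac (f : (Fin (n + 1) → ℝ) → Cl n) : (Fin (n + 1) → ℝ) → Cl n :=
  fun x => pderiv 0 f x + ∑ i : Fin n, mul (e i) (pderiv i.succ f x)

/-- Upper half-space `H⁺ = {x ∈ ℝ^{n+1} : xₙ > 0}`. -/
def upperHalf (n : ℕ) : Set (Fin (n + 1) → ℝ) := {x | 0 < x (Fin.last n)}

/-- The Euclidean norm on `ℝ^m`. -/
def enorm {m : ℕ} (x : Fin m → ℝ) : ℝ := Real.sqrt (∑ i, x i ^ 2)

end Cl

namespace Cl

variable {n : ℕ}

lemma prod_symmDiff {ι : Type*} [DecidableEq ι] (A B : Finset ι) (h : ι → ℝ)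
    (hh : ∀ i, h i * h i = 1) :
    ∏ i ∈ A ∆ B, h i = (∏ i ∈ A, h i) * ∏ i ∈ B, h i := by
  have hI : (∏ i ∈ A ∩ B, h i) * ∏ i ∈ A ∩ B, h i = 1 := by
    rw [← Finset.prod_mul_distrib]
    exact Finset.prod_eq_one fun i _ => hh i
  have hA : (∏ i ∈ A ∩ B, h i) * ∏ i ∈ A \ B, h i = ∏ i ∈ A, h i :=
    Finset.prod_inter_mul_prod_sdiff A B h
  have hB : (∏ i ∈ A ∩ B, h i) * ∏ i ∈ B \ A, h i = ∏ i ∈ B, h i := by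
    rw [Finset.inter_comm]
    exact Finset.prod_inter_mul_prod_sdiff B A h
  rw [symmDiff_def, Finset.sup_eq_union, Finset.prod_union disjoint_sdiff_sdiff, ← hA, ← hB]
  linear_combination (-((∏ i ∈ A \ B, h i) * ∏ i ∈ B \ A, h i)) * hI

lemma mulSign_eq_prod (A B : Finset (Fin n)) :
    mulSign A B = ∏ i ∈ A, ∏ j ∈ B, if j ≤ i then (-1 : ℝ) else 1 := by
  have h₁ : (A ∩ B).card = ((A ×ˢ B).filter fun p => p.2 = p.1).card := by
    refine Finset.card_bij (fun i _ => (i, i)) (by simp) (by simp) ?_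
    rintro ⟨i, j⟩ hij
    simp only [Finset.mem_filter, Finset.mem_product] at hij
    obtain ⟨⟨hi, hj⟩, rfl⟩ := hij
    exact ⟨j, by simp [hi, hj], rfl⟩
  have h₂ : ((A ×ˢ B).filter fun p => p.2 < p.1).card + (A ∩ B).card =
      ((A ×ˢ B).filter fun p => p.2 ≤ p.1).card := by
    rw [h₁, ← Finset.card_union_of_disjoint, ← Finset.filter_or]
    · simp only [le_iff_lt_or_eq]
    · rw [Finset.disjoint_filter]
      exact fun p _ hp => hp.ne
  rw [mulSign, h₂, ← Finset.prod_product', Finset.prod_ite]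
  simp

lemma mulSign_mul_self (A B : Finset (Fin n)) : mulSign A B * mulSign A B = 1 := by
  rw [mulSign, ← mul_pow]
  simp

lemma mulSign_symmDiff_left (A B C : Finset (Fin n)) :
    mulSign (A ∆ B) C = mulSign A C * mulSign B C := by
  simp only [mulSign_eq_prod]
  refine prod_symmDiff A B _ fun i => ?_
  rw [← Finset.prod_mul_distrib]
  exact Finset.prod_eq_one fun j _ => by split_ifs <;> norm_num

lemma mulSign_symmDiff_right (A B C : Finset (Fin n)) :
    mulSign A (B ∆ C) = mulSign A B * mulSign A C := by
  simp only [mulSign_eq_prod]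
  rw [← Finset.prod_mul_distrib]
  refine Finset.prod_congr rfl fun i _ => prod_symmDiff B C _ fun j => ?_
  split_ifs <;> norm_num

lemma mulSign_self (A : Finset (Fin n)) :
    mulSign A A = (-1) ^ (A.card * (A.card + 1) / 2) := by
  induction A using Finset.induction_on_max with
  | empty => simp [mulSign_eq_prod]
  | insert a s hs ih =>
    have ha : a ∉ s := fun h => lt_irrefl _ (hs a h)
    have h₁ : ∏ j ∈ s, (if j ≤ a then (-1 : ℝ) else 1) = (-1) ^ s.card := by
      rw [Finset.prod_congr rfl fun j hj => if_pos (hs j hj).le]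
      simp
    have h₂ : ∏ i ∈ s, ∏ j ∈ insert a s, (if j ≤ i then (-1 : ℝ) else 1) = mulSign s s := by
      rw [mulSign_eq_prod]
      refine Finset.prod_congr rfl fun i hi => ?_
      rw [Finset.prod_insert ha, if_neg (not_le.2 (hs i hi)), one_mul]
    rw [mulSign_eq_prod, Finset.prod_insert ha, h₂, Finset.prod_insert ha, h₁, ih,
      Finset.card_insert_of_notMem ha, if_pos le_rfl, ← pow_succ', ← pow_add]
    congr 1
    have : (s.card + 1) * (s.card + 1 + 1) = s.card * (s.card + 1) + (s.card + 1) * 2 := by ring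
    rw [this, Nat.add_mul_div_right _ _ two_pos, add_comm]

lemma conj_apply (a : Cl n) (A : Finset (Fin n)) : conj a A = mulSign A A * a A := by
  rw [mulSign_self]
  rfl

lemma reverse_apply (a : Cl n) (A : Finset (Fin n)) :
    reverse a A = (-1) ^ A.card * mulSign A A * a A := by
  rw [mulSign_self, reverse, ← pow_add]
  congr 1
  rcases A.card with _ | k
  · simp
  · have : (k + 1) * (k + 1 + 1) = (k + 1) * k + (k + 1) * 2 := by ring
    rw [this, Nat.add_mul_div_right _ _ two_pos, Nat.add_sub_cancel,
      show k + 1 + ((k + 1) * k / 2 + (k + 1)) = (k + 1) * k / 2 + 2 * (k + 1) by ring,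
      pow_add, pow_mul]
    simp

lemma mul_apply (a b : Cl n) (C : Finset (Fin n)) :
    mul a b C = ∑ A, mulSign A (A ∆ C) * a A * b (A ∆ C) := by
  refine Finset.sum_congr rfl fun A _ => ?_
  rw [Finset.sum_eq_single (A ∆ C)]
  · rw [if_pos (symmDiff_symmDiff_cancel_left A C)]
  · intro B _ hB
    refine if_neg fun h => hB ?_
    rw [← h, symmDiff_symmDiff_cancel_left]
  · simp

lemma sum_symmDiff_left (C : Finset (Fin n)) (F : Finset (Fin n) → ℝ) :
    ∑ A, F (C ∆ A) = ∑ A, F A :=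
  Equiv.sum_comp (Function.Involutive.toPerm (C ∆ ·) (symmDiff_symmDiff_cancel_left C)) F

@[ext]
lemma ext {a b : Cl n} (h : ∀ A, a A = b A) : a = b := funext h

lemma add_apply (a b : Cl n) (A : Finset (Fin n)) : (a + b) A = a A + b A := rfl

lemma smul_apply (r : ℝ) (a : Cl n) (A : Finset (Fin n)) : (r • a) A = r * a A := rfl

lemma zero_apply (A : Finset (Fin n)) : (0 : Cl n) A = 0 := rfl

lemma mul_assoc' (a b c : Cl n) : mul (mul a b) c = mul a (mul b c) := by
  ext D
  simp only [mul_apply, Finset.mul_sum, Finset.sum_mul]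
  rw [Finset.sum_comm]
  refine Finset.sum_congr rfl fun A _ => ?_
  rw [← sum_symmDiff_left A]
  refine Finset.sum_congr rfl fun F _ => ?_
  rw [symmDiff_symmDiff_cancel_left, symmDiff_assoc A F D, symmDiff_left_comm F A D]
  simp only [mulSign_symmDiff_left, mulSign_symmDiff_right]
  linear_combination (mulSign A A * mulSign F A * mulSign F F * mulSign A D * mulSign F D * a A *
    b F * c (A ∆ (F ∆ D))) * mulSign_mul_self A F

/-- The multiple `r • e_A` of the basis element `e_A`. -/
def single (A : Finset (Fin n)) (r : ℝ) : Cl n := fun C => if C = A then r else 0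

lemma single_apply (A : Finset (Fin n)) (r : ℝ) (C : Finset (Fin n)) :
    single A r C = if C = A then r else 0 := rfl

lemma one_eq_single : (one : Cl n) = single ∅ 1 := funext fun C => Pi.single_apply ∅ 1 C

lemma e_eq_single (i : Fin n) : e i = single {i} 1 :=
  funext fun C => Pi.single_apply ({i} : Finset (Fin n)) (1 : ℝ) C

lemma scalar_eq_single (r : ℝ) : (scalar r : Cl n) = single ∅ r :=
  funext fun C => Pi.single_apply ∅ r C

lemma mul_single (a : Cl n) (B : Finset (Fin n)) (r : ℝ) (C : Finset (Fin n)) :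
    mul a (single B r) C = mulSign (C ∆ B) B * a (C ∆ B) * r := by
  rw [mul_apply, Finset.sum_eq_single (C ∆ B)]
  · rw [symmDiff_comm C B, symmDiff_symmDiff_cancel_right, single_apply, if_pos rfl]
  · intro A _ hA
    rw [single_apply, if_neg, mul_zero]
    rintro rfl
    exact hA (by rw [symmDiff_comm A C, symmDiff_symmDiff_cancel_left])
  · simp

lemma single_mul (a : Cl n) (A : Finset (Fin n)) (r : ℝ) (C : Finset (Fin n)) :
    mul (single A r) a C = mulSign A (A ∆ C) * r * a (A ∆ C) := by
  rw [mul_apply, Finset.sum_eq_single A]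
  · rw [single_apply, if_pos rfl]
  · intro B _ hB
    rw [single_apply, if_neg hB, mul_zero, zero_mul]
  · simp

lemma single_mul_single (A B : Finset (Fin n)) (r s : ℝ) :
    mul (single A r) (single B s) = single (A ∆ B) (mulSign A B * r * s) := by
  ext C
  rw [mul_single, single_apply, single_apply]
  by_cases h : C = A ∆ B
  · simp [h, symmDiff_symmDiff_cancel_right]
  · rw [if_neg h, if_neg, mul_zero, zero_mul]
    rintro rfl
    exact h (symmDiff_symmDiff_cancel_right B C).symm

lemma mulSign_empty_left (A : Finset (Fin n)) : mulSign ∅ A = 1 := by simp [mulSign_eq_prod]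

lemma mulSign_empty_right (A : Finset (Fin n)) : mulSign A ∅ = 1 := by simp [mulSign_eq_prod]

lemma zero_mul' (a : Cl n) : mul 0 a = 0 := by
  ext C
  rw [mul_apply]
  simp [zero_apply]

lemma smul_mul' (r : ℝ) (a b : Cl n) : mul (r • a) b = r • mul a b := by
  ext C
  simp only [mul_apply, smul_apply, Finset.mul_sum]
  exact Finset.sum_congr rfl fun A _ => by ring

lemma mul_smul' (r : ℝ) (a b : Cl n) : mul a (r • b) = r • mul a b := by
  ext C
  simp only [mul_apply, smul_apply, Finset.mul_sum]
  exact Finset.sum_congr rfl fun A _ => by ring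

local instance instRing : Ring (Cl n) :=
  { (inferInstance : AddCommGroup (Cl n)) with
    mul := mul
    one := one
    mul_assoc := mul_assoc'
    one_mul := fun a => by
      ext C
      change mul one a C = a C
      rw [one_eq_single, single_mul, mulSign_empty_left, ← Finset.bot_eq_empty, bot_symmDiff,
        one_mul, one_mul]
    mul_one := fun a => by
      ext C
      change mul a one C = a C
      rw [one_eq_single, mul_single, mulSign_empty_right, ← Finset.bot_eq_empty, symmDiff_bot,
        one_mul, mul_one]
    zero_mul := zero_mul'
    mul_zero := fun a => by
      ext C
      refine (mul_apply a 0 C).trans ?_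
      simp [zero_apply]
    left_distrib := fun a b c => by
      ext C
      refine (mul_apply a (b + c) C).trans ?_
      simp only [add_apply, mul_add, Finset.sum_add_distrib]
      exact congrArg₂ (· + ·) (mul_apply a b C).symm (mul_apply a c C).symm
    right_distrib := fun a b c => by
      ext C
      refine (mul_apply (a + b) c C).trans ?_
      simp only [add_apply, mul_add, add_mul, Finset.sum_add_distrib]
      exact congrArg₂ (· + ·) (mul_apply a c C).symm (mul_apply b c C).symm }

lemma mul_def (a b : Cl n) : mul a b = a * b := rfl

lemma one_def : (one : Cl n) = 1 := rfl

lemma one_apply (A : Finset (Fin n)) : (1 : Cl n) A = if A = ∅ then 1 else 0 := by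
  rw [← one_def, one_eq_single, single_apply]

lemma e_apply (i : Fin n) (A : Finset (Fin n)) : e i A = if A = {i} then 1 else 0 := by
  rw [e_eq_single, single_apply]

local instance instAlgebra : Algebra ℝ (Cl n) :=
  Algebra.ofModule smul_mul' mul_smul'

lemma conj_mul (a b : Cl n) : conj (a * b) = conj b * conj a := by
  ext C
  rw [conj_apply, ← mul_def, ← mul_def, mul_apply, mul_apply, Finset.mul_sum,
    ← sum_symmDiff_left C (fun B => mulSign B (B ∆ C) * conj b B * conj a (B ∆ C))]
  refine Finset.sum_congr rfl fun A _ => ?_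
  rw [symmDiff_comm C A, symmDiff_symmDiff_cancel_right, conj_apply, conj_apply]
  simp only [mulSign_symmDiff_left, mulSign_symmDiff_right]
  have hAA := mulSign_mul_self A A
  have hCA := mulSign_mul_self C A
  linear_combination (- mulSign C C * mulSign A C * mulSign A A * a A * b (A ∆ C)) *
    ((mulSign C A * mulSign C A) * hAA + hCA)

lemma conj_add (a b : Cl n) : conj (a + b) = conj a + conj b := by
  ext A
  simp only [conj_apply, add_apply, mul_add]

lemma conj_smul (r : ℝ) (a : Cl n) : conj (r • a) = r • conj a := by
  ext A
  simp only [conj_apply, smul_apply]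
  ring

lemma conj_zero : conj (0 : Cl n) = 0 := by
  ext A
  simp only [conj_apply, zero_apply, mul_zero]

lemma norm_nonneg (a : Cl n) : 0 ≤ norm a := Real.sqrt_nonneg _

lemma norm_sq (a : Cl n) : norm a ^ 2 = ∑ A, a A ^ 2 :=
  Real.sq_sqrt (Finset.sum_nonneg fun A _ => sq_nonneg (a A))

lemma mul_conj_coeff_empty (a : Cl n) : (a * conj a) ∅ = norm a ^ 2 := by
  rw [norm_sq, ← mul_def, mul_apply]
  refine Finset.sum_congr rfl fun A _ => ?_
  rw [← Finset.bot_eq_empty, symmDiff_bot, conj_apply]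
  linear_combination a A ^ 2 * mulSign_mul_self A A

lemma eq_zero_of_norm_eq_zero {a : Cl n} (h : norm a = 0) : a = 0 := by
  have hs : ∑ A, a A ^ 2 = 0 := by rw [← norm_sq, h, zero_pow two_ne_zero]
  rw [Finset.sum_eq_zero_iff_of_nonneg fun A _ => sq_nonneg (a A)] at hs
  ext A
  exact pow_eq_zero_iff two_ne_zero |>.1 (hs A (Finset.mem_univ A))

/-- The product of `a` with its conjugate is the scalar `‖a‖²`, on both sides. -/
def HasScalarNorm (a : Cl n) : Prop :=
  a * conj a = (norm a ^ 2) • (1 : Cl n) ∧ conj a * a = (norm a ^ 2) • (1 : Cl n)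

lemma hasScalarNorm_of_eq_smul_one {a : Cl n} {r : ℝ} (h₁ : a * conj a = r • (1 : Cl n))
    (h₂ : conj a * a = r • (1 : Cl n)) : HasScalarNorm a := by
  have hr : norm a ^ 2 = r := by
    rw [← mul_conj_coeff_empty, h₁, smul_apply, one_apply, if_pos rfl, mul_one]
  exact ⟨by rw [hr, h₁], by rw [hr, h₂]⟩

lemma HasScalarNorm.mul {a b : Cl n} (ha : HasScalarNorm a) (hb : HasScalarNorm b) :
    HasScalarNorm (a * b) := by
  refine hasScalarNorm_of_eq_smul_one (r := norm a ^ 2 * norm b ^ 2) ?_ ?_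
  · rw [conj_mul, mul_assoc, ← mul_assoc b, hb.1, smul_mul_assoc, one_mul, mul_smul_comm, ha.1,
      smul_smul, mul_comm]
  · rw [conj_mul, mul_assoc, ← mul_assoc _ a, ha.2, smul_mul_assoc, one_mul, mul_smul_comm, hb.2,
      smul_smul]

lemma scalar_eq_smul (r : ℝ) : (scalar r : Cl n) = r • (1 : Cl n) := by
  ext A
  rw [scalar_eq_single, single_apply, smul_apply, one_apply, mul_ite, mul_one, mul_zero]

lemma conj_one : conj (1 : Cl n) = 1 := by
  ext A
  rw [conj_apply, one_apply]
  split_ifs with h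
  · rw [h, mulSign_empty_left, mul_one]
  · rw [mul_zero]

lemma mulSign_singleton (i j : Fin n) :
    mulSign {i} {j} = if j ≤ i then -1 else 1 := by
  simp [mulSign_eq_prod]

lemma conj_e (i : Fin n) : conj (e i) = -e i := by
  ext A
  rw [conj_apply]
  change mulSign A A * e i A = -(e i A)
  rw [e_apply]
  split_ifs with h
  · simp [h, mulSign_singleton]
  · simp

lemma e_mul_e_add (i j : Fin n) :
    e i * e j + e j * e i = (if i = j then (-2 : ℝ) else 0) • (1 : Cl n) := by
  rw [← mul_def, ← mul_def, e_eq_single, e_eq_single, single_mul_single, single_mul_single,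
    symmDiff_comm ({j} : Finset (Fin n)), mulSign_singleton, mulSign_singleton]
  ext C
  rw [add_apply, smul_apply, one_apply, single_apply, single_apply]
  rcases lt_trichotomy i j with h | rfl | h
  · rw [if_pos h.le, if_neg h.not_ge, if_neg h.ne]
    split_ifs <;> norm_num
  · rw [symmDiff_self, Finset.bot_eq_empty, if_pos le_rfl, if_pos rfl]
    split_ifs <;> norm_num
  · rw [if_pos h.le, if_neg h.not_ge, if_neg h.ne']
    split_ifs <;> norm_num

/-- The vector part of a paravector. -/
def vec (x : Fin n → ℝ) : Cl n := ∑ i, x i • e i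

lemma conj_vec (x : Fin n → ℝ) : conj (vec x) = -vec x := by
  let conjHom : Cl n →+ Cl n := ⟨⟨conj, conj_zero⟩, conj_add⟩
  change conjHom _ = _
  rw [vec, map_sum, ← Finset.sum_neg_distrib]
  refine Finset.sum_congr rfl fun i _ => ?_
  change conj _ = _
  rw [conj_smul, conj_e, smul_neg]

lemma vec_mul_vec (x : Fin n → ℝ) : vec x * vec x = (-∑ i, x i ^ 2) • (1 : Cl n) := by
  have h₁ : vec x * vec x = ∑ i, ∑ j, (x i * x j) • (e i * e j) := by
    rw [vec, Finset.sum_mul_sum]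
    simp only [smul_mul_smul_comm]
  have h₂ : vec x * vec x = ∑ i, ∑ j, (x i * x j) • (e j * e i) := by
    rw [h₁, Finset.sum_comm]
    exact Finset.sum_congr rfl fun i _ => Finset.sum_congr rfl fun j _ => by
      rw [mul_comm (x j)]
  have h₃ : (2 : ℝ) • (vec x * vec x) = (2 : ℝ) • (-∑ i, x i ^ 2) • (1 : Cl n) := by
    rw [two_smul ℝ (vec x * vec x)]
    nth_rewrite 1 [h₁]
    rw [h₂, ← Finset.sum_add_distrib, smul_smul, mul_neg, Finset.mul_sum,
      ← Finset.sum_neg_distrib, Finset.sum_smul]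
    refine Finset.sum_congr rfl fun i _ => ?_
    rw [← Finset.sum_add_distrib, Finset.sum_eq_single i]
    · rw [← smul_add, e_mul_e_add, if_pos rfl, smul_smul]
      congr 1
      ring
    · intro j _ hj
      rw [← smul_add, e_mul_e_add, if_neg hj.symm, zero_smul, smul_zero]
    · simp
  exact smul_right_injective _ (two_ne_zero' ℝ) h₃

lemma para_eq (x : Fin (n + 1) → ℝ) :
    (para x : Cl n) = x 0 • (1 : Cl n) + vec fun i => x i.succ := by
  rw [para, scalar_eq_smul, vec]

lemma hasScalarNorm_para (x : Fin (n + 1) → ℝ) : HasScalarNorm (para x : Cl n) := by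
  have hc : conj (para x : Cl n) = x 0 • (1 : Cl n) - vec fun i => x i.succ := by
    rw [para_eq, conj_add, conj_smul, conj_one, conj_vec, sub_eq_add_neg]
  have hr : (x 0 ^ 2) • (1 : Cl n) - (vec fun i => x i.succ) * (vec fun i => x i.succ) =
      (x 0 ^ 2 + ∑ i : Fin n, x i.succ ^ 2) • (1 : Cl n) := by
    rw [vec_mul_vec, neg_smul, sub_neg_eq_add, add_smul]
  refine hasScalarNorm_of_eq_smul_one (r := x 0 ^ 2 + ∑ i : Fin n, x i.succ ^ 2) ?_ ?_ <;>
  · rw [hc, para_eq, ← hr]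
    simp only [add_mul, mul_add, sub_mul, mul_sub, smul_mul_assoc, mul_smul_comm, one_mul, mul_one,
      sq]
    module

lemma IsProdOfParavectors.hasScalarNorm {a : Cl n} (ha : IsProdOfParavectors a) :
    HasScalarNorm a := by
  obtain ⟨l, -, rfl⟩ := ha
  induction l with
  | nil =>
    have h : (1 : Cl n) * conj 1 = (1 : ℝ) • (1 : Cl n) := by rw [conj_one, one_mul, one_smul]
    exact hasScalarNorm_of_eq_smul_one h (by
      rwa [List.foldr_nil, one_def, mul_one, ← one_mul (conj 1)])
  | cons x l ih => exact (hasScalarNorm_para x).mul ih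

lemma hasScalarNorm_zero : HasScalarNorm (0 : Cl n) :=
  hasScalarNorm_of_eq_smul_one (r := 0) (by simp) (by simp)

lemma HasScalarNorm.inv_eq {a : Cl n} (ha : HasScalarNorm a) (h0 : norm a ≠ 0) :
    inv a = (norm a ^ 2)⁻¹ • conj a := by
  have h₂ : norm a ^ 2 ≠ 0 := pow_ne_zero 2 h0
  have hl : a * ((norm a ^ 2)⁻¹ • conj a) = 1 := by
    rw [mul_smul_comm, ha.1, inv_smul_smul₀ h₂]
  have hr : ((norm a ^ 2)⁻¹ • conj a) * a = 1 := by
    rw [smul_mul_assoc, ha.2, inv_smul_smul₀ h₂]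
  have hinv : IsInvertible a := ⟨_, hl, hr⟩
  have hchoose : a * hinv.choose = 1 := hinv.choose_spec.1
  rw [inv, dif_pos hinv]
  calc hinv.choose = ((norm a ^ 2)⁻¹ • conj a) * a * hinv.choose := by rw [hr, one_mul]
    _ = _ := by rw [mul_assoc, hchoose, mul_one]

lemma HasScalarNorm.mul_inv {a : Cl n} (ha : HasScalarNorm a) (h0 : norm a ≠ 0) :
    a * inv a = 1 := by
  rw [ha.inv_eq h0, mul_smul_comm, ha.1, inv_smul_smul₀ (pow_ne_zero 2 h0)]

lemma para_add (x y : Fin (n + 1) → ℝ) : (para (x + y) : Cl n) = para x + para y := by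
  simp only [para_eq, vec, Pi.add_apply, add_smul, Finset.sum_add_distrib]
  abel

lemma hasScalarNorm_cxd (M : SAV n) (x : Fin (n + 1) → ℝ) : HasScalarNorm (cxd M x) := by
  by_cases hc : M.c = 0
  · rw [cxd, hc, mul_def, zero_mul, zero_add]
    rcases M.prod_d with h | h
    · rw [h]
      exact hasScalarNorm_zero
    · exact h.hasScalarNorm
  · have hs := (M.prod_c.resolve_left hc).hasScalarNorm
    obtain ⟨y, hy⟩ := (M.cond_c hc).2
    have hd : M.d = M.c * para y := by
      rw [← hy, mul_def, ← mul_assoc, hs.mul_inv (mt eq_zero_of_norm_eq_zero hc), one_mul]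
    rw [cxd, hd, mul_def, ← mul_add, ← para_add]
    exact hs.mul (hasScalarNorm_para _)

lemma memSub.mul {a b : Cl n} {i : Fin n} (ha : memSub a i) (hb : memSub b i) :
    memSub (a * b) i := by
  intro C hC
  rw [coeff, ← mul_def, mul_apply]
  refine Finset.sum_eq_zero fun A _ => ?_
  by_cases hA : i ∈ A
  · rw [show a A = 0 from ha A hA, mul_zero, zero_mul]
  · rw [show b (A ∆ C) = 0 from hb _ (Finset.mem_symmDiff.2 (Or.inr ⟨hC, hA⟩)), mul_zero]

lemma memSub.conj {a : Cl n} {i : Fin n} (ha : memSub a i) : memSub (conj a) i := by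
  intro C hC
  rw [coeff, conj_apply, show a C = 0 from ha C hC, mul_zero]

lemma memSub.add {a b : Cl n} {i : Fin n} (ha : memSub a i) (hb : memSub b i) :
    memSub (a + b) i := by
  intro C hC
  rw [coeff, add_apply, show a C = 0 from ha C hC, show b C = 0 from hb C hC, add_zero]

lemma memSub.smul {a : Cl n} {i : Fin n} (r : ℝ) (ha : memSub a i) : memSub (r • a) i := by
  intro C hC
  rw [coeff, smul_apply, show a C = 0 from ha C hC, mul_zero]

lemma memSub_one (i : Fin n) : memSub (1 : Cl n) i := by
  intro C hC
  rw [coeff, one_apply, if_neg]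
  rintro rfl
  simp at hC

lemma memSub_e {i j : Fin n} (h : i ≠ j) : memSub (e j) i := by
  intro C hC
  rw [coeff, e_apply, if_neg]
  rintro rfl
  exact h (by simpa using hC)

lemma memSub_sum {ι : Type*} (s : Finset ι) (F : ι → Cl n) {i : Fin n}
    (h : ∀ k ∈ s, memSub (F k) i) : memSub (∑ k ∈ s, F k) i :=
  Finset.sum_induction F (memSub · i) (fun _ _ => memSub.add) (fun _ _ => rfl) h

lemma exists_para_eq_add_smul_e {m : ℕ} (x : Fin (m + 2) → ℝ) :
    ∃ w : Cl (m + 1), memSub w (Fin.last m) ∧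
      para x = w + x (Fin.last (m + 1)) • e (Fin.last m) := by
  refine ⟨x 0 • (1 : Cl (m + 1)) + ∑ i : Fin m, x i.castSucc.succ • e i.castSucc, ?_, ?_⟩
  · exact ((memSub_one _).smul _).add (memSub_sum _ _ fun i _ =>
      (memSub_e (Fin.castSucc_lt_last i).ne').smul _)
  · rw [para_eq, vec, Fin.sum_univ_castSucc, ← add_assoc]
    rfl

lemma e_last_mul_conj {m : ℕ} {a : Cl (m + 1)} (ha : memSub a (Fin.last m)) :
    e (Fin.last m) * conj a = reverse a * e (Fin.last m) := by
  ext C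
  rw [← mul_def, ← mul_def, e_eq_single, mul_single, single_mul, conj_apply, reverse_apply,
    symmDiff_comm C]
  generalize {Fin.last m} ∆ C = B
  by_cases hB : Fin.last m ∈ B
  · rw [show a B = 0 from ha B hB]
    ring
  · have h₁ : mulSign {Fin.last m} B = (-1) ^ B.card := by
      simp [mulSign_eq_prod, Fin.le_last]
    have h₂ : mulSign B {Fin.last m} = 1 := by
      simp only [mulSign_eq_prod, Finset.prod_singleton]
      refine Finset.prod_eq_one fun i hi => if_neg fun h => hB ?_
      rwa [← Fin.last_le_iff.1 h]
    rw [h₁, h₂]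
    ring

lemma moebius_last {m : ℕ} (M : SAVsub m) (x : Fin (m + 2) → ℝ) (h0 : norm (cxd M.toSAV x) ≠ 0) :
    moebius M.toSAV x (Fin.last (m + 1)) =
      x (Fin.last (m + 1)) / norm (cxd M.toSAV x) ^ 2 := by
  obtain ⟨w, hw, hx⟩ := exists_para_eq_add_smul_e x
  set t := x (Fin.last (m + 1))
  set E : Cl (m + 1) := e (Fin.last m)
  have hdet : M.a * reverse M.d - M.b * reverse M.c = 1 := M.det
  have hpara := (hasScalarNorm_para x : HasScalarNorm (para x : Cl (m + 1))).1
  have hconj : conj (para x : Cl (m + 1)) = conj w - t • E := by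
    rw [hx, conj_add, conj_smul, conj_e, smul_neg, sub_eq_add_neg]
  have key : axb M.toSAV x * conj (cxd M.toSAV x) =
      ((norm (para x : Cl (m + 1)) ^ 2) • (M.a * conj M.c) + M.a * w * conj M.d +
        M.b * conj w * conj M.c + M.b * conj M.d) + t • E := by
    calc axb M.toSAV x * conj (cxd M.toSAV x)
        = M.a * (para x * conj (para x)) * conj M.c + M.a * para x * conj M.d +
          M.b * conj (para x) * conj M.c + M.b * conj M.d := by
          rw [axb, cxd, mul_def, mul_def, conj_add, conj_mul]
          noncomm_ring
      _ = ((norm (para x : Cl (m + 1)) ^ 2) • (M.a * conj M.c) + M.a * w * conj M.d +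
            M.b * conj w * conj M.c + M.b * conj M.d) +
          t • (M.a * (E * conj M.d) - M.b * (E * conj M.c)) := by
          rw [hpara, hconj, hx]
          simp only [mul_add, add_mul, mul_sub, sub_mul, mul_smul_comm, smul_mul_assoc, mul_one,
            smul_sub, mul_assoc]
          abel
      _ = _ := by
          rw [e_last_mul_conj M.sub_d, e_last_mul_conj M.sub_c, ← mul_assoc, ← mul_assoc,
            ← sub_mul, hdet, one_mul]
  have hsub := ((((M.sub_a.mul M.sub_c.conj).smul (norm (para x : Cl (m + 1)) ^ 2)).add
    ((M.sub_a.mul hw).mul M.sub_d.conj)).add ((M.sub_b.mul hw.conj).mul M.sub_c.conj)).add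
    (M.sub_b.mul M.sub_d.conj) {Fin.last m} (Finset.mem_singleton_self _)
  have hE : E {Fin.last m} = 1 := (e_apply _ _).trans (if_pos rfl)
  rw [coeff] at hsub
  change (axb M.toSAV x * inv (cxd M.toSAV x)) {Fin.last m} = _
  rw [(hasScalarNorm_cxd M.toSAV x).inv_eq h0, mul_smul_comm, smul_apply, key, add_apply, hsub,
    smul_apply, hE, zero_add, mul_one, inv_mul_eq_div]

end Cl

/-- If `f` is an automorphic form of weight factor `conj(cx+d)/‖cx+d‖^{n+1-k}`, then
`g = xₙ^{-(1-n+k)/2} f` transforms with the weight `-1` factor `conj(cx+d)/‖cx+d‖²`.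
Here `n = m + 2 ≥ 2`. -/
theorem reduction_to_weight_minus_one
    (m : ℕ) (k : ℤ) (hk : Even k)
    (M : Cl.SAVsub (m + 1))
    (f : (Fin (m + 3) → ℝ) → Cl (m + 2))
    (hf : ∀ x ∈ Cl.upperHalf (m + 2),
      f x = (Cl.norm (Cl.cxd M.toSAV x) ^ (((m : ℤ) + 2) + 1 - k))⁻¹ •
        Cl.mul (Cl.conj (Cl.cxd M.toSAV x)) (f (Cl.moebius M.toSAV x)))
    (g : (Fin (m + 3) → ℝ) → Cl (m + 2))
    (hg : g = fun y =>
      (y (Fin.last (m + 2)) ^ (-(1 - ((m : ℝ) + 2) + (k : ℝ)) / 2)) • f y) :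
    ∀ x ∈ Cl.upperHalf (m + 2),
      g x = (Cl.norm (Cl.cxd M.toSAV x) ^ 2)⁻¹ •
        Cl.mul (Cl.conj (Cl.cxd M.toSAV x)) (g (Cl.moebius M.toSAV x)) := by
  intro x hx
  have hx0 : 0 < x (Fin.last (m + 2)) := hx
  subst hg
  dsimp only
  rw [hf x hx]
  by_cases h0 : Cl.norm (Cl.cxd M.toSAV x) = 0
  · rw [Cl.eq_zero_of_norm_eq_zero h0, Cl.conj_zero]
    simp only [Cl.zero_mul', smul_zero]
  · rw [Cl.moebius_last M x h0]
    set N := Cl.norm (Cl.cxd M.toSAV x)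
    have hN : 0 < N := lt_of_le_of_ne (Cl.norm_nonneg _) (Ne.symm h0)
    simp only [Cl.mul_smul', smul_smul]
    congr 1
    have hexp : (N ^ 2) ^ (-(1 - ((m : ℝ) + 2) + (k : ℝ)) / 2) =
        N ^ ((m : ℤ) + 2 + 1 - k) / N ^ 2 := by
      rw [← Real.rpow_natCast N 2, ← Real.rpow_mul hN.le, ← Real.rpow_intCast, ← Real.rpow_sub hN]
      congr 1
      push_cast
      ring
    rw [Real.div_rpow hx0.le (sq_nonneg N), hexp]
    have := zpow_ne_zero ((m : ℤ) + 2 + 1 - k) h0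
    field_simp
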